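/- arXiv:2506.18065 — 2 statements merged into one kernel-verified Lean document; each statement's English description precedes it below -/
import Mathlib

section
/- Let p be prime, k ≥ 1, and let g ∈ ℤ[s,t] be a separable binary form of degree d ≥ 1 with content h_g, and set σ = v_p(h_g). Assume σ < k. Then λ_g(p^k) ≤ (d+1) · min{ (k+1) p^{k(2 − 1/d) + σ/d}, p^{2k − 1} }, where λ_g(q) = #{ (u,v) ∈ (ℤ/qℤ)² : g(u,v) ≡ 0 mod q }. -/
open MvPolynomial in
/-- The binary form `Σ_i c_i X^(d-i) Y^i` as a polynomial over `ℚ`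
(used to express separability as squarefreeness). -/
noncomputable def binFormQ (d : ℕ) (c : Fin (d + 1) → ℤ) : MvPolynomial (Fin 2) ℚ :=
  ∑ i : Fin (d + 1), C ((c i : ℚ)) * X 0 ^ (d - (i : ℕ)) * X 1 ^ (i : ℕ)

/-- Evaluation of the binary form with coefficients `c` at a point of `(ℤ/qℤ)²`. -/
def binEvalZMod (d q : ℕ) (c : Fin (d + 1) → ℤ) (u v : ZMod q) : ZMod q :=
  ∑ i : Fin (d + 1), (c i : ZMod q) * u ^ (d - (i : ℕ)) * v ^ (i : ℕ)

/-- The binary form `Σ_{i ≤ d} c_i x^(d-i) y^i` evaluated in a commutative ring. -/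
def binForm {A : Type*} [CommRing A] (d : ℕ) (c : ℕ → ℤ) (x y : A) : A :=
  ∑ i ∈ Finset.range (d + 1), (c i : A) * x ^ (d - i) * y ^ i

section Division

variable {A : Type*} [CommRing A]

theorem binForm_succ (d : ℕ) (c : ℕ → ℤ) (x y : A) :
    binForm (d + 1) c x y = x * binForm d c x y + c (d + 1) * y ^ (d + 1) := by
  unfold binForm
  rw [Finset.sum_range_succ _ (d + 1), Finset.mul_sum]
  congr 1
  · refine Finset.sum_congr rfl fun i hi => ?_
    rw [Nat.succ_sub (by simpa [Nat.lt_succ_iff] using hi), pow_succ]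
    ring
  · simp

theorem binForm_reflect (d : ℕ) (c : ℕ → ℤ) (x y : A) :
    binForm d (fun i => c (d - i)) y x = binForm d c x y := by
  unfold binForm
  rw [← Finset.sum_range_reflect]
  refine Finset.sum_congr rfl fun i hi => ?_
  have hi' : i ≤ d := by simpa [Nat.lt_succ_iff] using hi
  have h1 : d + 1 - 1 - i = d - i := by omega
  have h2 : d - (d - i) = i := by omega
  simp only [h1, h2]
  ring

theorem binForm_mul (d : ℕ) (c : ℕ → ℤ) (x y z : A) :
    binForm d c (z * x) (z * y) = z ^ d * binForm d c x y := by
  unfold binForm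
  rw [Finset.mul_sum]
  refine Finset.sum_congr rfl fun i hi => ?_
  have hi' : i ≤ d := by simpa [Nat.lt_succ_iff] using hi
  conv_rhs => rw [← Nat.sub_add_cancel hi', pow_add]
  rw [Nat.sub_add_cancel hi']
  ring

/-- Division of a binary form by the linear form vanishing at `(u, v)`. -/
theorem exists_binForm_division (d : ℕ) (c : ℕ → ℤ) (u v : ℤ) :
    ∃ h : ℕ → ℤ, ∀ (A : Type) [CommRing A] (x y : A),
      (u : A) ^ (d + 1) * binForm (d + 1) c x y =
        (u * y - v * x) * binForm d h x y + (binForm (d + 1) c u v : ℤ) * x ^ (d + 1) := by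
  induction d with
  | zero =>
    refine ⟨fun _ => c 1, fun A _ x y => ?_⟩
    simp [binForm, Finset.sum_range_succ]
    ring
  | succ d ih =>
    obtain ⟨h, hh⟩ := ih
    refine ⟨fun i => (if i ≤ d then u * h i else 0) + c (d + 2) * u ^ i * v ^ (d + 1 - i),
      fun A _ x y => ?_⟩
    have key : binForm (d + 1)
        (fun i => (if i ≤ d then u * h i else 0) + c (d + 2) * u ^ i * v ^ (d + 1 - i)) x y =
        u * x * binForm d h x y + c (d + 2) *
          ∑ i ∈ Finset.range (d + 2), (u * y) ^ i * (v * x) ^ (d + 2 - 1 - i) := by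
      have h1 : binForm (d + 1) (fun i => if i ≤ d then u * h i else 0) x y =
          u * x * binForm d h x y := by
        rw [binForm_succ]
        simp only [binForm, Finset.mul_sum]
        rw [if_neg (by omega)]
        simp only [Int.cast_zero, zero_mul, add_zero]
        refine Finset.sum_congr rfl fun i hi => ?_
        rw [if_pos (by simpa [Nat.lt_succ_iff] using hi)]
        push_cast
        ring
      rw [← h1]
      unfold binForm
      rw [Finset.mul_sum, ← Finset.sum_add_distrib]
      refine Finset.sum_congr rfl fun i hi => ?_
      have h2 : d + 2 - 1 - i = d + 1 - i := by omega
      rw [h2]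
      push_cast
      ring
    have geom := (Commute.all ((u : A) * y) (v * x)).geom_sum₂_mul (d + 2)
    simp only [show d + 2 - 1 = d + 1 from rfl] at geom key
    have e1 := hh A x y
    rw [key, binForm_succ (d + 1) c x y, binForm_succ (d + 1) c u v]
    push_cast at e1 ⊢
    linear_combination (u : A) * x * e1 - (c (d + 2) : A) * geom

theorem exists_binForm_division_of_primitive {p : ℤ} (d : ℕ) (c : ℕ → ℤ) (u v : ℤ)
    (huv : ¬ (p ∣ u ∧ p ∣ v)) :
    ∃ (w : ℤ) (h : ℕ → ℤ), ¬ p ∣ w ∧ ∀ (A : Type) [CommRing A] (x y : A),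
      ((binForm (d + 1) c u v : ℤ) : A) ∣
        (w : A) ^ (d + 1) * binForm (d + 1) c x y - (u * y - v * x) * binForm d h x y := by
  by_cases hu : p ∣ u
  · have hv : ¬ p ∣ v := fun hv => huv ⟨hu, hv⟩
    obtain ⟨h, hh⟩ := exists_binForm_division d (fun i => c (d + 1 - i)) v u
    refine ⟨v, fun i => - h (d - i), hv, fun A _ x y => ⟨y ^ (d + 1), ?_⟩⟩
    have e := hh A y x
    have hneg : binForm d (fun i => - h (d - i)) x y = - binForm d h y x := by
      rw [← binForm_reflect d h y x]
      simp [binForm]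
    rw [binForm_reflect, binForm_reflect] at e
    rw [hneg]
    linear_combination e
  · obtain ⟨h, hh⟩ := exists_binForm_division d c u v
    refine ⟨u, h, hu, fun A _ x y => ⟨x ^ (d + 1), ?_⟩⟩
    linear_combination hh A x y

end Division

section Divisibility

theorem Prime.pow_sub_dvd_of_pow_dvd_mul {p a b : ℤ} (hp : Prime p) {m e : ℕ}
    (h : p ^ m ∣ a * b) (ha : ¬ p ^ (e + 1) ∣ a) : p ^ (m - e) ∣ b := by
  induction e generalizing m a with
  | zero =>
    refine hp.pow_dvd_of_dvd_mul_left m ?_ h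
    simpa using ha
  | succ e ih =>
    by_cases hpa : p ∣ a
    · obtain ⟨a', rfl⟩ := hpa
      have ha' : ¬ p ^ (e + 1) ∣ a' := fun hd => ha (by
        rw [pow_succ']
        exact mul_dvd_mul_left p hd)
      cases m with
      | zero => simp
      | succ m =>
        have hm : p ^ m ∣ a' * b := by
          rw [pow_succ', mul_assoc] at h
          exact (mul_dvd_mul_iff_left hp.ne_zero).1 h
        simpa using ih hm ha'
    · exact (pow_dvd_pow p (Nat.sub_le _ _)).trans (hp.pow_dvd_of_dvd_mul_left m hpa h)

open Polynomial in
theorem intCast_dvd_binForm_one_X {p : ℤ} {d : ℕ} {c : ℕ → ℤ} :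
    ((p : ℤ) : ℤ[X]) ∣ binForm d c 1 X ↔ ∀ i ≤ d, p ∣ c i := by
  rw [← Polynomial.C_eq_intCast, Polynomial.C_dvd_iff_dvd_coeff]
  have hc (i : ℕ) : (binForm d c 1 X : ℤ[X]).coeff i = if i ≤ d then c i else 0 := by
    simp only [binForm, Polynomial.finsetSum_coeff, ← Polynomial.C_eq_intCast, one_pow, mul_one,
      Polynomial.coeff_C_mul_X_pow]
    simp
  simp only [hc]
  exact ⟨fun h i hi => by simpa [hi] using h i, fun h i => by
    split_ifs with hi
    exacts [h i hi, dvd_zero p]⟩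

/-- If a binary form of degree `d` is highly divisible by `p` at more than `d` primitive points
which are pairwise `p`-adically far apart, then `p` divides the form. -/
theorem dvd_coeff_of_pow_dvd_binForm {p : ℤ} (hp : Prime p) {d m e : ℕ} {c : ℕ → ℤ}
    (hm : d * e < m) (S : Finset (ℤ × ℤ)) (hS : d < S.card)
    (hprim : ∀ P ∈ S, ¬ (p ∣ P.1 ∧ p ∣ P.2))
    (hdvd : ∀ P ∈ S, p ^ m ∣ binForm d c P.1 P.2)
    (hdet : ∀ P ∈ S, ∀ Q ∈ S, P ≠ Q → ¬ p ^ (e + 1) ∣ P.1 * Q.2 - P.2 * Q.1) :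
    ∀ i ≤ d, p ∣ c i := by
  induction d generalizing m c S with
  | zero =>
    obtain ⟨P, hP⟩ := Finset.card_pos.1 hS
    have h := (dvd_pow_self p (by omega : m ≠ 0)).trans (hdvd P hP)
    intro i hi
    obtain rfl : i = 0 := by omega
    simpa [binForm] using h
  | succ d ih =>
    obtain ⟨P, hP⟩ := Finset.card_pos.1 (by omega : 0 < S.card)
    obtain ⟨w, h, hw, hh⟩ :=
      exists_binForm_division_of_primitive d c P.1 P.2 (hprim P hP)
    have hmem {Q : ℤ × ℤ} (hQ : Q ∈ S.erase P) : Q ∈ S := Finset.mem_of_mem_erase hQ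
    have hdvd_h : ∀ i ≤ d, p ∣ h i := by
      refine ih (m := m - e) (by rw [add_mul] at hm; omega) (S.erase P) ?_
        (fun Q hQ => hprim Q (hmem hQ)) (fun Q hQ => ?_)
        (fun Q hQ R hR => hdet Q (hmem hQ) R (hmem hR))
      · rw [Finset.card_erase_of_mem hP]
        omega
      · refine hp.pow_sub_dvd_of_pow_dvd_mul (a := P.1 * Q.2 - P.2 * Q.1) ?_
          (hdet P hP Q (hmem hQ) (Finset.ne_of_mem_erase hQ).symm)
        have h1 := (hdvd P hP).trans (by simpa using hh ℤ Q.1 Q.2)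
        exact (dvd_sub_right ((hdvd Q (hmem hQ)).mul_left _)).1 h1
    rw [← intCast_dvd_binForm_one_X] at hdvd_h ⊢
    have h1 := hh (Polynomial ℤ) 1 Polynomial.X
    have hpP : ((p : ℤ) : Polynomial ℤ) ∣ ((binForm (d + 1) c P.1 P.2 : ℤ) : Polynomial ℤ) :=
      Int.cast_dvd_cast _ _ ((dvd_pow_self p (by omega : m ≠ 0)).trans (by
        simpa using hdvd P hP))
    have h2 := (dvd_sub_left (hdvd_h.mul_left _)).1 (hpP.trans h1)
    have hpX : Prime ((p : ℤ) : Polynomial ℤ) := by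
      rw [← Polynomial.C_eq_intCast]
      exact Polynomial.prime_C_iff.2 hp
    refine (hpX.dvd_or_dvd h2).resolve_left fun h3 => hw ?_
    have h4 := hpX.dvd_of_dvd_pow h3
    rw [← Polynomial.C_eq_intCast, ← Polynomial.C_eq_intCast, Polynomial.C_dvd_iff_dvd_coeff] at h4
    simpa using h4 0

end Divisibility

section Counting

/-- The number of points of a box on a primitive line modulo `p ^ e`. -/
theorem card_filter_dvd_det_le {p : ℕ} (hp : p.Prime) {k e : ℕ} (he : e ≤ k) (Q : ℕ × ℕ)
    (hQ : ¬ (p ∣ Q.1 ∧ p ∣ Q.2)) :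
    ((Finset.range (p ^ k) ×ˢ Finset.range (p ^ k)).filter fun P =>
      (p : ℤ) ^ e ∣ (P.1 : ℤ) * Q.2 - P.2 * Q.1).card ≤ p ^ (2 * k - e) := by
  have hpos : 0 < p ^ e := pow_pos hp.pos e
  have hdiv {u : ℕ} (hu : u < p ^ k) : u / p ^ e < p ^ (k - e) := by
    rw [Nat.div_lt_iff_lt_mul hpos, ← pow_add, Nat.sub_add_cancel he]
    exact hu
  have heq {a b r : ℕ} (hr : ¬ p ∣ r) (hab : (p : ℤ) ^ e ∣ ((a : ℤ) - b) * r)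
      (h : a / p ^ e = b / p ^ e) : a = b := by
    have h1 := (Nat.prime_iff_prime_int.1 hp).pow_dvd_of_dvd_mul_right e
      (by exact_mod_cast hr) hab
    have h2 : b ≡ a [MOD p ^ e] := (Nat.modEq_iff_dvd).2 (by exact_mod_cast h1)
    rw [← Nat.div_add_mod a (p ^ e), ← Nat.div_add_mod b (p ^ e), h, h2]
  have hcard : (Finset.range (p ^ k) ×ˢ Finset.range (p ^ (k - e))).card = p ^ (2 * k - e) := by
    rw [Finset.card_product, Finset.card_range, Finset.card_range, ← pow_add]
    congr 1
    omega
  rw [← hcard]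
  by_cases hQ1 : p ∣ Q.1
  · have hQ2 : ¬ p ∣ Q.2 := fun h => hQ ⟨hQ1, h⟩
    refine Finset.card_le_card_of_injOn (fun P => (P.2, P.1 / p ^ e)) ?_ ?_
    · intro P hP
      simp only [Finset.coe_filter, Finset.mem_product, Finset.mem_range, Set.mem_ofPred_eq] at hP
      simpa using ⟨hP.1.2, hdiv hP.1.1⟩
    · rintro ⟨a, b⟩ hP ⟨a', b'⟩ hP' h
      simp only [Finset.coe_filter, Set.mem_ofPred_eq, Prod.mk.injEq] at hP hP' h
      obtain ⟨rfl, h⟩ := h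
      rw [heq hQ2 ((dvd_sub hP.2 hP'.2).trans (dvd_of_eq (by ring))) h]
  · refine Finset.card_le_card_of_injOn (fun P => (P.1, P.2 / p ^ e)) ?_ ?_
    · intro P hP
      simp only [Finset.coe_filter, Finset.mem_product, Finset.mem_range, Set.mem_ofPred_eq] at hP
      simpa using ⟨hP.1.1, hdiv hP.1.2⟩
    · rintro ⟨a, b⟩ hP ⟨a', b'⟩ hP' h
      simp only [Finset.coe_filter, Set.mem_ofPred_eq, Prod.mk.injEq] at hP hP' h
      obtain ⟨rfl, h⟩ := h
      rw [heq hQ1 ((dvd_sub hP'.2 hP.2).trans (dvd_of_eq (by ring))) h]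

/-- The solutions of `binForm d c ≡ 0` modulo `p ^ m` in the box of side `p ^ k`. -/
def binFormSolutions (p k m d : ℕ) (c : ℕ → ℤ) : Finset (ℕ × ℕ) :=
  (Finset.range (p ^ k) ×ˢ Finset.range (p ^ k)).filter fun P =>
    (p : ℤ) ^ m ∣ binForm d c (P.1 : ℤ) (P.2 : ℤ)

theorem card_primitive_binFormSolutions_le {p : ℕ} (hp : p.Prime) {d m k e : ℕ} {c : ℕ → ℤ}
    (hm : d * e < m) (he : e + 1 ≤ k) (hc : ∃ i ≤ d, ¬ (p : ℤ) ∣ c i) :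
    ((binFormSolutions p k m d c).filter fun P => ¬ (p ∣ P.1 ∧ p ∣ P.2)).card ≤
      d * p ^ (2 * k - (e + 1)) := by
  classical
  set T := (binFormSolutions p k m d c).filter fun P => ¬ (p ∣ P.1 ∧ p ∣ P.2) with hT
  have hmemT {P : ℕ × ℕ} (hP : P ∈ T) :
      (P ∈ Finset.range (p ^ k) ×ˢ Finset.range (p ^ k) ∧
        (p : ℤ) ^ m ∣ binForm d c (P.1 : ℤ) (P.2 : ℤ)) ∧ ¬ (p ∣ P.1 ∧ p ∣ P.2) := by
    simpa only [hT, binFormSolutions, Finset.mem_filter] using hP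
  let sep : Finset (ℕ × ℕ) → Prop := fun S => ∀ P ∈ S, ∀ Q ∈ S, P ≠ Q →
    ¬ (p : ℤ) ^ (e + 1) ∣ (P.1 : ℤ) * Q.2 - P.2 * Q.1
  obtain ⟨S, hS, hmax⟩ := (T.powerset.filter sep).exists_max_image Finset.card
    ⟨∅, by simp [sep]⟩
  obtain ⟨hST, hsep⟩ : S ⊆ T ∧ sep S := by simpa using hS
  have hcardS : S.card ≤ d := by
    by_contra! hlt
    obtain ⟨i, hi, hci⟩ := hc
    refine hci (dvd_coeff_of_pow_dvd_binForm (Nat.prime_iff_prime_int.1 hp) hm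
      (S.map (Nat.castEmbedding.prodMap Nat.castEmbedding)) (by simpa using hlt) ?_ ?_ ?_ i hi)
    · intro _ hmem
      obtain ⟨P, hP, rfl⟩ := Finset.mem_map.1 hmem
      have := (hmemT (hST hP)).2
      simpa [Int.natCast_dvd_natCast] using this
    · intro _ hmem
      obtain ⟨P, hP, rfl⟩ := Finset.mem_map.1 hmem
      simpa using (hmemT (hST hP)).1.2
    · intro _ hmem _ hmem' hPQ
      obtain ⟨P, hP, rfl⟩ := Finset.mem_map.1 hmem
      obtain ⟨Q, hQ, rfl⟩ := Finset.mem_map.1 hmem'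
      simpa using hsep P hP Q hQ (fun h => hPQ (by rw [h]))
  have hcover : T ⊆ S.biUnion fun Q => (Finset.range (p ^ k) ×ˢ Finset.range (p ^ k)).filter
      fun P => (p : ℤ) ^ (e + 1) ∣ (P.1 : ℤ) * Q.2 - P.2 * Q.1 := by
    intro P hP
    by_contra hcon
    simp only [Finset.mem_biUnion, Finset.mem_filter, (hmemT hP).1.1, true_and,
      not_exists, not_and] at hcon
    have hPS : P ∉ S := fun h => hcon P h (by simp [mul_comm])
    have hins := hmax (insert P S) (by
      simp only [Finset.mem_filter, Finset.mem_powerset]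
      refine ⟨Finset.insert_subset hP hST, fun Q hQ R hR hQR => ?_⟩
      rcases Finset.mem_insert.1 hQ with rfl | hQS <;>
        rcases Finset.mem_insert.1 hR with rfl | hRS
      · exact absurd rfl hQR
      · exact hcon R hRS
      · intro h
        exact hcon Q hQS ((dvd_neg.2 h).trans (dvd_of_eq (by ring)))
      · exact hsep Q hQS R hRS hQR)
    rw [Finset.card_insert_of_notMem hPS] at hins
    omega
  calc T.card ≤ _ := Finset.card_le_card hcover
    _ ≤ S.card * p ^ (2 * k - (e + 1)) := Finset.card_biUnion_le_card_mul _ _ _ fun Q hQ =>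
        card_filter_dvd_det_le hp he Q (hmemT (hST hQ)).2
    _ ≤ _ := Nat.mul_le_mul_right _ hcardS

theorem card_binFormSolutions_le {p : ℕ} (hp : p.Prime) {d m k e : ℕ} {c : ℕ → ℤ}
    (hm : d * e < m + d) (he : e ≤ k) (hc : ∃ i ≤ d, ¬ (p : ℤ) ∣ c i) :
    (binFormSolutions p k m d c).card ≤ (d * e + 1) * p ^ (2 * k - e) := by
  induction e generalizing m k with
  | zero =>
    refine (Finset.card_filter_le _ _).trans ?_
    simp [two_mul, pow_add]
  | succ e ih =>
    obtain ⟨k, rfl⟩ : ∃ l, k = l + 1 := ⟨k - 1, by omega⟩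
    have hm' : d * e < m := by rw [mul_add] at hm; omega
    have himprim : ((binFormSolutions p (k + 1) m d c).filter fun P =>
        ¬ ¬ (p ∣ P.1 ∧ p ∣ P.2)).card ≤ (binFormSolutions p k (m - d) d c).card := by
      refine (Finset.card_le_card (t := (binFormSolutions p k (m - d) d c).image
        fun P => (p * P.1, p * P.2)) ?_).trans Finset.card_image_le
      rintro ⟨a, b⟩ hP
      simp only [binFormSolutions, Finset.mem_filter, Finset.mem_product, Finset.mem_range,
        not_not] at hP
      obtain ⟨⟨⟨ha, hb⟩, h⟩, ⟨a, rfl⟩, ⟨b, rfl⟩⟩ := hP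
      refine Finset.mem_image.2 ⟨(a, b), ?_, rfl⟩
      rw [pow_succ', Nat.mul_lt_mul_left hp.pos] at ha hb
      simp only [binFormSolutions, Finset.mem_filter, Finset.mem_product, Finset.mem_range]
      refine ⟨⟨ha, hb⟩, ?_⟩
      push_cast at h
      rw [binForm_mul] at h
      rcases le_total m d with hmd | hmd
      · simp [Nat.sub_eq_zero_of_le hmd]
      · rw [← Nat.add_sub_cancel' hmd, pow_add] at h
        exact (mul_dvd_mul_iff_left (pow_ne_zero _ (by exact_mod_cast hp.ne_zero))).1 h
    rw [← Finset.card_filter_add_card_filter_not fun P : ℕ × ℕ => ¬ (p ∣ P.1 ∧ p ∣ P.2)]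
    calc _ ≤ d * p ^ (2 * (k + 1) - (e + 1)) + (d * e + 1) * p ^ (2 * k - e) :=
          add_le_add (card_primitive_binFormSolutions_le hp hm' he hc)
            (himprim.trans (ih (by omega) (by omega)))
      _ ≤ d * p ^ (2 * (k + 1) - (e + 1)) + (d * e + 1) * p ^ (2 * (k + 1) - (e + 1)) :=
          Nat.add_le_add_left (Nat.mul_le_mul_left _ (Nat.pow_le_pow_right hp.pos (by omega))) _
      _ = _ := by ring

/-- A nonzero family of integers is `p ^ σ` times a family with an entry prime to `p`. -/
theorem exists_eq_pow_mul_of_gcd_factorization {p : ℕ} (hp : p.Prime) {d : ℕ}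
    (c : Fin (d + 1) → ℤ) (hc : c ≠ 0) :
    ∃ c' : ℕ → ℤ, (∀ i : Fin (d + 1),
      c i = (p : ℤ) ^ (Finset.univ.gcd fun i => (c i).natAbs).factorization p * c' i) ∧
      ∃ i ≤ d, ¬ (p : ℤ) ∣ c' i := by
  set g := Finset.univ.gcd fun i => (c i).natAbs with hg
  have hg0 : g ≠ 0 := fun h => hc (funext fun i => by
    simpa using Finset.gcd_eq_zero_iff.1 h i (Finset.mem_univ i))
  have hdvd (i : Fin (d + 1)) : (p : ℤ) ^ g.factorization p ∣ c i := by
    have h : p ^ g.factorization p ∣ (c i).natAbs :=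
      (Nat.ordProj_dvd g p).trans (Finset.gcd_dvd (Finset.mem_univ i))
    exact_mod_cast Int.natCast_dvd.2 h
  choose c' hc' using hdvd
  refine ⟨fun i => if h : i < d + 1 then c' ⟨i, h⟩ else 0, fun i => by simpa [i.is_lt, i.is_le] using hc' i, ?_⟩
  by_contra! hall
  refine Nat.pow_succ_factorization_not_dvd hg0 hp (Finset.dvd_gcd fun i _ => ?_)
  rw [← Int.natCast_dvd, hc' i]
  push_cast
  rw [pow_succ]
  exact mul_dvd_mul_left _ (by simpa [i.is_le] using hall i i.is_le)

theorem card_binEvalZMod_eq_zero_le {p : ℕ} (hp : p.Prime) {k d σ : ℕ} (hσ : σ ≤ k)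
    (c : Fin (d + 1) → ℤ) (c' : ℕ → ℤ) (hc : ∀ i : Fin (d + 1), c i = (p : ℤ) ^ σ * c' i) :
    Nat.card {uv : ZMod (p ^ k) × ZMod (p ^ k) |
        binEvalZMod d (p ^ k) c uv.1 uv.2 = 0} ≤ (binFormSolutions p k (k - σ) d c').card := by
  have : NeZero (p ^ k) := ⟨pow_ne_zero _ hp.ne_zero⟩
  have hmem (uv : {uv : ZMod (p ^ k) × ZMod (p ^ k) | binEvalZMod d (p ^ k) c uv.1 uv.2 = 0}) :
      (uv.1.1.val, uv.1.2.val) ∈ binFormSolutions p k (k - σ) d c' := by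
    obtain ⟨⟨u, v⟩, huv⟩ := uv
    simp only [binFormSolutions, Finset.mem_filter, Finset.mem_product, Finset.mem_range]
    refine ⟨⟨u.val_lt, v.val_lt⟩, ?_⟩
    have hcast : (((p : ℤ) ^ σ * binForm d c' (u.val : ℤ) (v.val : ℤ) : ℤ) : ZMod (p ^ k)) =
        binEvalZMod d (p ^ k) c u v := by
      rw [binEvalZMod, binForm, Finset.sum_range, Finset.mul_sum, Int.cast_sum]
      refine Finset.sum_congr rfl fun i _ => ?_
      rw [hc i]
      push_cast
      rw [ZMod.natCast_zmod_val, ZMod.natCast_zmod_val]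
      ring
    have h0 := hcast.trans huv
    have hpow : (p : ℤ) ^ k = (p : ℤ) ^ σ * (p : ℤ) ^ (k - σ) := by
      rw [← pow_add, Nat.add_sub_cancel' hσ]
    rw [ZMod.intCast_zmod_eq_zero_iff_dvd, Nat.cast_pow, hpow] at h0
    exact (mul_dvd_mul_iff_left (pow_ne_zero _ (by exact_mod_cast hp.ne_zero))).1 h0
  rw [← Fintype.card_coe, ← Nat.card_eq_fintype_card]
  refine Nat.card_le_card_of_injective (fun uv => ⟨_, hmem uv⟩) fun a b hab => ?_
  simp only [Subtype.mk.injEq, Prod.mk.injEq] at hab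
  exact Subtype.ext (Prod.ext (ZMod.val_injective _ hab.1) (ZMod.val_injective _ hab.2))

end Counting

/-- If `g` is a separable binary form of degree `d ≥ 1` whose content has
`p`-adic valuation `σ < k`, then
`λ_g(p^k) ≤ (d+1) min((k+1) p^(k(2-1/d)+σ/d), p^(2k-1))`. -/
theorem stmt_9 (p : ℕ) (hp : p.Prime) (k : ℕ) (hk : 1 ≤ k)
    (d : ℕ) (hd : 1 ≤ d) (c : Fin (d + 1) → ℤ)
    (hsep : Squarefree (binFormQ d c))
    (σ : ℕ) (hσdef : σ = (Finset.univ.gcd fun i => (c i).natAbs).factorization p)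
    (hσ : σ < k) :
    (Nat.card {uv : ZMod (p ^ k) × ZMod (p ^ k) |
        binEvalZMod d (p ^ k) c uv.1 uv.2 = 0} : ℝ)
      ≤ (d + 1 : ℝ) *
        min (((k : ℝ) + 1) * (p : ℝ) ^ ((k : ℝ) * (2 - 1 / d) + (σ : ℝ) / d))
          ((p : ℝ) ^ (2 * (k : ℝ) - 1)) := by
  have hc0 : c ≠ 0 := by
    rintro rfl
    exact hsep.ne_zero (by simp [binFormQ])
  obtain ⟨c', hc', hprim⟩ := exists_eq_pow_mul_of_gcd_factorization hp c hc0
  rw [← hσdef] at hc'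
  have hN := card_binEvalZMod_eq_zero_le hp hσ.le c c' hc'
  set N := Nat.card {uv : ZMod (p ^ k) × ZMod (p ^ k) | binEvalZMod d (p ^ k) c uv.1 uv.2 = 0}
  have hp1 : (1 : ℝ) ≤ p := by exact_mod_cast hp.one_le
  have hbound {e : ℕ} (he : d * e < k - σ + d) :
      e ≤ k ∧ (N : ℝ) ≤ (d * e + 1) * (p : ℝ) ^ (2 * (k : ℝ) - e) := by
    have hek : e ≤ k := by
      by_contra! hlt
      have h1 : d * (k + 1) ≤ d * e := Nat.mul_le_mul_left d hlt
      have h2 : k ≤ d * k := Nat.le_mul_of_pos_left k hd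
      rw [mul_add] at h1
      omega
    refine ⟨hek, ?_⟩
    have h := hN.trans (card_binFormSolutions_le hp he hek hprim)
    have hpow : (p : ℝ) ^ (2 * (k : ℝ) - e) = (p : ℝ) ^ (2 * k - e) := by
      rw [← Real.rpow_natCast, Nat.cast_sub (by omega)]
      push_cast
      rfl
    rw [hpow]
    exact_mod_cast h
  have hd0 : (0 : ℝ) < d := by exact_mod_cast hd
  rw [mul_min_of_nonneg _ _ (by positivity)]
  refine le_min ?_ ?_
  · set e := (k - σ + d - 1) / d with he
    have hlt : d * e < k - σ + d := by
      have := Nat.mul_div_le (k - σ + d - 1) d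
      rw [← he] at this
      omega
    have hge : k ≤ d * e + σ := by
      have := Nat.lt_mul_div_succ (k - σ + d - 1) hd
      rw [← he, mul_add] at this
      omega
    obtain ⟨hek, hNe⟩ := hbound hlt
    have hek' : (e : ℝ) ≤ k := by exact_mod_cast hek
    have hge' : (k : ℝ) ≤ d * e + σ := by exact_mod_cast hge
    rw [← mul_assoc]
    refine hNe.trans (mul_le_mul ?_ (Real.rpow_le_rpow_of_exponent_le hp1 ?_) (by positivity)
      (by positivity))
    · nlinarith
    · have h1 : ((k : ℝ) - σ) / d ≤ e := by
        rw [div_le_iff₀ hd0]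
        linarith
      have h2 : (k : ℝ) * (2 - 1 / d) + σ / d = 2 * k - (k - σ) / d := by ring
      rw [h2]
      linarith
  · simpa using (hbound (e := 1) (by omega)).2
end

section
/- Let p be a prime, and let g ∈ ℤ[s,t] be a separable binary form of degree d whose content is not divisible by p. Then the 'local factor' ξ_p = 1 + Σ_{j≥1} b(p^j) λ_g(p^j) / p^{2j}, with |b(p^j)| ≤ (j+1)^{e+1} and λ_g(p^j) ≤ (d+1)(j+1) min(p^{2j−1}, p^{j(2−1/d)}), satisfies ξ_p ≥ 1 − Σ_{j=1}^{d} d(j+1)^{e+2}/p − Σ_{j ≥ d+1} d(j+1)^{e+2}/p^{j/d}. In particular ξ_p = 1 + O_{d,e}(1/p) and for p larger than a constant depending only on d and e, ξ_p > 0. -/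
/-- `λ_g(q) = #{(u,v) ∈ (ℤ/qℤ)² : g(u,v) ≡ 0}`. -/
noncomputable def lamG (d q : ℕ) (c : Fin (d + 1) → ℤ) : ℕ :=
  Nat.card {uv : ZMod q × ZMod q | binEvalZMod d q c uv.1 uv.2 = 0}

theorem dvd_right_of_pow_dvd_mul {p : ℤ} (hp : Prime p) {m K : ℕ} {x y : ℤ}
    (hx : ¬ p ^ (m + 1) ∣ x) (h : p ^ K ∣ x * y) : p ^ (K - m) ∣ y := by
  have hx0 : x ≠ 0 := by rintro rfl; exact hx (dvd_zero _)
  obtain ⟨w, hxw, hw⟩ :=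
    (FiniteMultiplicity.of_prime_left hp hx0).exists_eq_pow_mul_and_not_dvd
  generalize multiplicity p x = r at hxw
  subst hxw
  have hr : r ≤ m := by
    by_contra! hlt
    exact hx ((pow_dvd_pow p hlt).mul_right w)
  rcases le_total K m with hK | hK
  · simp [Nat.sub_eq_zero_of_le hK]
  have h1 : p ^ r * p ^ (K - r) ∣ p ^ r * (w * y) := by
    rw [← pow_add, Nat.add_sub_cancel' (hr.trans hK), ← mul_assoc]
    exact h
  have h2 : p ^ (K - r) ∣ w * y := (mul_dvd_mul_iff_left (pow_ne_zero r hp.ne_zero)).1 h1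
  exact (pow_dvd_pow p (by omega)).trans (hp.pow_dvd_of_dvd_mul_left _ hw h2)

/-- A polynomial of degree at most `d` taking values highly divisible by `p` at `d + 1` integers
that are not too close `p`-adically has content divisible by `p`. -/
theorem C_dvd_of_pow_dvd_eval {p : ℤ} (hp : Prime p) (m : ℕ) :
    ∀ (d : ℕ) (G : Polynomial ℤ) (S : Finset ℤ) (K : ℕ), G.natDegree ≤ d → S.card = d + 1 →
      (∀ x ∈ S, ∀ y ∈ S, x ≠ y → ¬ p ^ (m + 1) ∣ x - y) → d * m < K →
      (∀ x ∈ S, p ^ K ∣ G.eval x) → Polynomial.C p ∣ G := by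
  intro d
  induction d with
  | zero =>
    intro G S K hG hS _ hK hev
    obtain ⟨t, rfl⟩ := Finset.card_eq_one.1 hS
    rw [Polynomial.eq_C_of_natDegree_le_zero hG] at hev ⊢
    have := hev t (by simp)
    rw [Polynomial.eval_C] at this
    exact map_dvd Polynomial.C ((dvd_pow_self p (by omega)).trans this)
  | succ d ih =>
    intro G S K hG hS hsep hK hev
    obtain ⟨t, ht⟩ := Finset.card_pos.1 (by omega : 0 < S.card)
    obtain ⟨H, hH⟩ : Polynomial.X - Polynomial.C t ∣ G - Polynomial.C (G.eval t) := by
      rw [Polynomial.dvd_iff_isRoot]; simp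
    have hGH : G = (Polynomial.X - Polynomial.C t) * H + Polynomial.C (G.eval t) := by
      rw [← hH]; ring
    have hHdeg : H.natDegree ≤ d := by
      by_cases h0 : H = 0
      · simp [h0]
      have h1 : (G - Polynomial.C (G.eval t)).natDegree ≤ d + 1 := by
        rw [Polynomial.natDegree_sub_C]; exact hG
      rw [hH, (Polynomial.monic_X_sub_C t).natDegree_mul' h0, Polynomial.natDegree_X_sub_C] at h1
      omega
    have hCH : Polynomial.C p ∣ H := by
      refine ih H (S.erase t) (K - m) hHdeg (by rw [Finset.card_erase_of_mem ht]; omega)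
        (fun x hx y hy => hsep x (Finset.mem_of_mem_erase hx) y (Finset.mem_of_mem_erase hy))
        (by rw [Nat.succ_mul] at hK; omega) ?_
      intro x hx
      refine dvd_right_of_pow_dvd_mul hp
        (hsep x (Finset.mem_of_mem_erase hx) t ht (Finset.ne_of_mem_erase hx)) ?_
      have h3 : (x - t) * H.eval x = G.eval x - G.eval t := by
        have := congrArg (Polynomial.eval x) hH
        simpa using this.symm
      rw [h3]
      exact dvd_sub (hev x (Finset.mem_of_mem_erase hx)) (hev t ht)
    rw [hGH]
    exact dvd_add (hCH.mul_left _)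
      (map_dvd Polynomial.C ((dvd_pow_self p (by omega)).trans (hev t ht)))

/-- The dehomogenised binary form `Σ_i c_i X^i`. -/
noncomputable def dehomForm (d : ℕ) (c : Fin (d + 1) → ℤ) : Polynomial ℤ :=
  ∑ i : Fin (d + 1), Polynomial.C (c i) * Polynomial.X ^ (i : ℕ)

theorem natDegree_dehomForm_le (d : ℕ) (c : Fin (d + 1) → ℤ) :
    (dehomForm d c).natDegree ≤ d := by
  refine Polynomial.natDegree_sum_le_of_forall_le _ _ fun i _ => ?_
  exact (Polynomial.natDegree_C_mul_X_pow_le _ _).trans (by omega)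

theorem coeff_dehomForm (d : ℕ) (c : Fin (d + 1) → ℤ) (i : Fin (d + 1)) :
    (dehomForm d c).coeff i = c i := by
  simp only [dehomForm, Polynomial.finsetSum_coeff, Polynomial.coeff_C_mul_X_pow]
  rw [Finset.sum_eq_single i]
  · simp
  · intro k _ hk
    rw [if_neg]
    exact fun h => hk (Fin.ext h.symm)
  · simp

theorem binEvalZMod_mul (d q : ℕ) (c : Fin (d + 1) → ℤ) (u t : ℤ) :
    binEvalZMod d q c (u : ZMod q) ((u : ZMod q) * (t : ZMod q)) =
      ((u ^ d * (dehomForm d c).eval t : ℤ) : ZMod q) := by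
  simp only [binEvalZMod, dehomForm, Polynomial.eval_finsetSum, Polynomial.eval_mul,
    Polynomial.eval_C, Polynomial.eval_pow, Polynomial.eval_X, Finset.mul_sum]
  push_cast
  refine Finset.sum_congr rfl fun i _ => ?_
  have : (u : ZMod q) ^ d = (u : ZMod q) ^ (d - (i : ℕ)) * (u : ZMod q) ^ (i : ℕ) := by
    rw [← pow_add]; congr 1; omega
  rw [this]; ring

theorem binEvalZMod_rev (d q : ℕ) (c : Fin (d + 1) → ℤ) (u v : ZMod q) :
    binEvalZMod d q (fun i => c i.rev) v u = binEvalZMod d q c u v := by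
  unfold binEvalZMod
  rw [← Equiv.sum_comp Fin.revPerm]
  refine Finset.sum_congr rfl fun i _ => ?_
  have h1 : d - ((Fin.revPerm i : Fin (d + 1)) : ℕ) = i := by
    simp [Fin.val_rev]; omega
  have h2 : ((Fin.revPerm i : Fin (d + 1)) : ℕ) = d - i := by
    simp [Fin.val_rev]
  rw [h1, h2]
  simp only [Fin.revPerm_apply, Fin.rev_rev]
  ring

open Classical in
/-- The zeros `v` of a binary form modulo `p ^ j` which are multiples of a fixed `u` lie in at most
`d` residue classes modulo `p ^ (k + 1)`, provided `d * k < j`. -/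
theorem card_image_zeros_le {p : ℕ} (hp : p.Prime) {d j k : ℕ} (hd : 1 ≤ d) (hk : d * k < j)
    (c : Fin (d + 1) → ℤ) (hc : ∃ i, ¬ (p : ℤ) ∣ c i) [NeZero (p ^ j)] (u : ZMod (p ^ j)) :
    ((Finset.univ.filter fun v : ZMod (p ^ j) => u ∣ v ∧ binEvalZMod d (p ^ j) c u v = 0).image
      fun v => v.val % p ^ (k + 1)).card ≤ d := by
  set A := Finset.univ.filter fun v : ZMod (p ^ j) => u ∣ v ∧ binEvalZMod d (p ^ j) c u v = 0
  have hpZ : Prime (p : ℤ) := Nat.prime_iff_prime_int.1 hp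
  have hkj : k + 1 ≤ j := by nlinarith
  have huval : (((u.val : ℕ) : ℤ) : ZMod (p ^ j)) = u := by simp
  have key : ∀ t t' : ℤ, (p : ℤ) ^ (k + 1) ∣ (u.val : ℤ) * (t - t') →
      (u * (t : ZMod (p ^ j))).val % p ^ (k + 1) = (u * (t' : ZMod (p ^ j))).val % p ^ (k + 1) := by
    intro t t' h
    have hrep : ∀ s : ℤ, ((p : ℤ) ^ (k + 1)) ∣
        ((u * (s : ZMod (p ^ j))).val : ℤ) - (u.val : ℤ) * s := by
      intro s
      refine (pow_dvd_pow (p : ℤ) hkj).trans ?_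
      have : ((p ^ j : ℕ) : ℤ) ∣ ((u * (s : ZMod (p ^ j))).val : ℤ) - (u.val : ℤ) * s := by
        rw [← ZMod.intCast_zmod_eq_zero_iff_dvd]
        push_cast
        simp
      exact_mod_cast this
    have h3 : ((p : ℤ) ^ (k + 1)) ∣
        ((u * (t : ZMod (p ^ j))).val : ℤ) - ((u * (t' : ZMod (p ^ j))).val : ℤ) := by
      have hadd := dvd_add (dvd_sub (hrep t) (hrep t')) h
      rwa [mul_sub, sub_sub_sub_comm, sub_add_cancel] at hadd
    have h4 := (Int.modEq_iff_dvd.2 h3).symm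
    unfold Int.ModEq at h4
    exact_mod_cast h4
  have hex : ∀ v ∈ A, ∃ t : ℤ, v = u * (t : ZMod (p ^ j)) := by
    intro v hv
    obtain ⟨w, rfl⟩ := (Finset.mem_filter.1 hv).2.1
    exact ⟨w.val, by simp⟩
  by_cases hu : (p : ℤ) ^ (k + 1) ∣ (u.val : ℤ)
  · refine (Finset.card_le_one.2 ?_).trans hd
    intro x hx y hy
    obtain ⟨v, hv, rfl⟩ := Finset.mem_image.1 hx
    obtain ⟨v', hv', rfl⟩ := Finset.mem_image.1 hy
    obtain ⟨t, rfl⟩ := hex v hv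
    obtain ⟨t', rfl⟩ := hex v' hv'
    exact key t t' (hu.mul_right _)
  · by_contra! hcard
    have hu0 : (u.val : ℤ) ≠ 0 := by intro h; exact hu (h ▸ dvd_zero _)
    obtain ⟨w, hau, hw⟩ :=
      (FiniteMultiplicity.of_prime_left hpZ hu0).exists_eq_pow_mul_and_not_dvd
    generalize multiplicity (p : ℤ) (u.val : ℤ) = a at hau
    have ha : a ≤ k := by
      by_contra! hlt
      exact hu (hau ▸ (pow_dvd_pow (p : ℤ) hlt).mul_right w)
    obtain ⟨R, hRA, hR⟩ := Finset.exists_subset_card_eq (Nat.succ_le_of_lt hcard)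
    have hpre : ∀ r ∈ R, ∃ t : ℤ, (u * (t : ZMod (p ^ j))) ∈ A ∧
        (u * (t : ZMod (p ^ j))).val % p ^ (k + 1) = r := by
      intro r hr
      obtain ⟨v, hv, hvr⟩ := Finset.mem_image.1 (hRA hr)
      obtain ⟨t, rfl⟩ := hex v hv
      exact ⟨t, hv, hvr⟩
    choose! T hTA hTr using hpre
    have hinj : Set.InjOn T R := by
      intro r hr s hs h
      rw [← hTr r hr, ← hTr s hs, h]
    obtain ⟨i, hi⟩ := hc
    refine hi ?_
    rw [← coeff_dehomForm d c i]
    refine Polynomial.C_dvd_iff_dvd_coeff _ _ |>.1 ?_ i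
    refine C_dvd_of_pow_dvd_eval hpZ (k - a) d _ (R.image T) (j - d * a)
      (natDegree_dehomForm_le d c) (by rw [Finset.card_image_of_injOn hinj, hR]) ?_ ?_ ?_
    · intro x hx y hy hxy hdvd
      obtain ⟨r, hr, rfl⟩ := Finset.mem_image.1 hx
      obtain ⟨s, hs, rfl⟩ := Finset.mem_image.1 hy
      refine hxy (congrArg T ?_)
      rw [← hTr r hr, ← hTr s hs]
      refine key _ _ ?_
      have : (p : ℤ) ^ (k + 1) = (p : ℤ) ^ a * (p : ℤ) ^ (k - a + 1) := by
        rw [← pow_add]; congr 1; omega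
      rw [this, hau]
      exact mul_dvd_mul (dvd_mul_right _ _) hdvd
    · rw [Nat.mul_sub]
      have := Nat.mul_le_mul_left d ha
      omega
    · intro x hx
      obtain ⟨r, hr, rfl⟩ := Finset.mem_image.1 hx
      have h0 := (Finset.mem_filter.1 (hTA r hr)).2.2
      have h1 := binEvalZMod_mul d (p ^ j) c (u.val : ℤ) (T r)
      rw [huval, h0] at h1
      have h2 := (ZMod.intCast_zmod_eq_zero_iff_dvd _ _).1 h1.symm
      rw [hau, mul_pow, ← pow_mul, mul_assoc] at h2
      have h3 : (p : ℤ) ^ (a * d) * (p : ℤ) ^ (j - d * a) ∣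
          (p : ℤ) ^ (a * d) * (w ^ d * (dehomForm d c).eval (T r)) := by
        rw [← pow_add]
        have := Nat.mul_le_mul_left d ha
        rw [show a * d + (j - d * a) = j by rw [mul_comm a d]; omega]
        exact_mod_cast h2
      have h4 := (mul_dvd_mul_iff_left (pow_ne_zero _ hpZ.ne_zero)).1 h3
      exact hpZ.pow_dvd_of_dvd_mul_left _ (fun h => hw (hpZ.dvd_of_dvd_pow h)) h4

open Classical in
theorem card_zeros_multiple_le {p : ℕ} (hp : p.Prime) {d j k : ℕ} (hd : 1 ≤ d) (hk : d * k < j)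
    (c : Fin (d + 1) → ℤ) (hc : ∃ i, ¬ (p : ℤ) ∣ c i) [NeZero (p ^ j)] (u : ZMod (p ^ j)) :
    (Finset.univ.filter fun v : ZMod (p ^ j) =>
      u ∣ v ∧ binEvalZMod d (p ^ j) c u v = 0).card ≤ p ^ (j - (k + 1)) * d := by
  have hkj : k + 1 ≤ j := by nlinarith
  refine (Finset.card_le_mul_card_image (f := fun v => v.val % p ^ (k + 1)) _ (p ^ (j - (k + 1)))
    ?_).trans (Nat.mul_le_mul_left _ (card_image_zeros_le hp hd hk c hc u))
  intro r _
  conv_rhs => rw [← Finset.card_range (p ^ (j - (k + 1)))]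
  refine Finset.card_le_card_of_injOn (fun v => v.val / p ^ (k + 1)) ?_ ?_
  · intro v _
    simp only [Finset.coe_range, Set.mem_Iio]
    refine Nat.div_lt_of_lt_mul ?_
    rw [← pow_add, Nat.add_sub_cancel' hkj]
    exact ZMod.val_lt v
  · intro v hv v' hv' h
    simp only [Finset.coe_filter, Set.mem_ofPred_eq] at hv hv'
    refine ZMod.val_injective _ ?_
    rw [← Nat.div_add_mod v.val (p ^ (k + 1)), ← Nat.div_add_mod v'.val (p ^ (k + 1)),
      hv.2, hv'.2]
    simp only at h
    rw [h]

theorem ZMod.dvd_total_of_prime_pow {p : ℕ} (hp : p.Prime) (j : ℕ) [NeZero (p ^ j)]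
    (u v : ZMod (p ^ j)) : u ∣ v ∨ v ∣ u := by
  have key : ∀ x : ZMod (p ^ j), ∃ a : ℕ, Associated ((p : ZMod (p ^ j)) ^ a) x := by
    intro x
    by_cases hx : x.val = 0
    · refine ⟨j, ?_⟩
      have h1 : (p : ZMod (p ^ j)) ^ j = 0 := by
        have := ZMod.natCast_self (p ^ j)
        push_cast at this
        exact this
      rw [h1, (ZMod.val_eq_zero x).1 hx]
    · obtain ⟨w, haw, hw⟩ :=
        (Nat.finiteMultiplicity_iff.2 ⟨hp.ne_one, Nat.pos_of_ne_zero hx⟩).exists_eq_pow_mul_and_not_dvd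
      have hcop : Nat.Coprime w (p ^ j) := ((hp.coprime_iff_not_dvd.2 hw).symm).pow_right j
      refine ⟨multiplicity p x.val, ZMod.unitOfCoprime w hcop, ?_⟩
      rw [ZMod.coe_unitOfCoprime, ← Nat.cast_pow, ← Nat.cast_mul, ← haw, ZMod.natCast_zmod_val]
  obtain ⟨a, ha⟩ := key u
  obtain ⟨a', ha'⟩ := key v
  rcases le_total a a' with h | h
  · exact Or.inl (ha.symm.dvd.trans ((pow_dvd_pow _ h).trans ha'.dvd))
  · exact Or.inr (ha'.symm.dvd.trans ((pow_dvd_pow _ h).trans ha.dvd))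

open Classical in
theorem lamG_prime_pow_le {p : ℕ} (hp : p.Prime) {d j k : ℕ} (hd : 1 ≤ d) (hk : d * k < j)
    (c : Fin (d + 1) → ℤ) (hc : ∃ i, ¬ (p : ℤ) ∣ c i) :
    lamG d (p ^ j) c ≤ 2 * (p ^ j * (p ^ (j - (k + 1)) * d)) := by
  have : NeZero (p ^ j) := ⟨pow_ne_zero _ hp.ne_zero⟩
  have hc' : ∃ i : Fin (d + 1), ¬ (p : ℤ) ∣ (fun i : Fin (d + 1) => c i.rev) i := by
    obtain ⟨i, hi⟩ := hc
    exact ⟨i.rev, by simpa using hi⟩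
  have hfib : ∀ c' : Fin (d + 1) → ℤ, (∃ i, ¬ (p : ℤ) ∣ c' i) →
      (Finset.univ.sigma fun u : ZMod (p ^ j) => Finset.univ.filter fun v : ZMod (p ^ j) =>
        u ∣ v ∧ binEvalZMod d (p ^ j) c' u v = 0).card ≤ p ^ j * (p ^ (j - (k + 1)) * d) := by
    intro c' h
    rw [Finset.card_sigma]
    refine (Finset.sum_le_card_nsmul _ _ _
      fun u _ => card_zeros_multiple_le hp hd hk c' h u).trans ?_
    simp [ZMod.card]
  have hsub : (Finset.univ.filter fun uv : ZMod (p ^ j) × ZMod (p ^ j) =>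
      binEvalZMod d (p ^ j) c uv.1 uv.2 = 0) ⊆
      ((Finset.univ.sigma fun u : ZMod (p ^ j) => Finset.univ.filter fun v : ZMod (p ^ j) =>
        u ∣ v ∧ binEvalZMod d (p ^ j) c u v = 0).image fun x => (x.1, x.2)) ∪
      ((Finset.univ.sigma fun u : ZMod (p ^ j) => Finset.univ.filter fun v : ZMod (p ^ j) =>
        u ∣ v ∧ binEvalZMod d (p ^ j) (fun i => c i.rev) u v = 0).image fun x => (x.2, x.1)) := by
    rintro ⟨u, v⟩ huv
    replace huv := (Finset.mem_filter.1 huv).2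
    rw [Finset.mem_union, Finset.mem_image, Finset.mem_image]
    rcases ZMod.dvd_total_of_prime_pow hp j u v with h | h
    · exact Or.inl ⟨⟨u, v⟩, by simp [h, huv], rfl⟩
    · exact Or.inr ⟨⟨v, u⟩, by simp [h, huv, binEvalZMod_rev], rfl⟩
  have hcard : lamG d (p ^ j) c = (Finset.univ.filter fun uv : ZMod (p ^ j) × ZMod (p ^ j) =>
      binEvalZMod d (p ^ j) c uv.1 uv.2 = 0).card := by
    unfold lamG
    rw [Nat.card_eq_fintype_card, Fintype.card_ofFinset]
    congr 1
  rw [hcard, two_mul]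
  exact (Finset.card_le_card hsub).trans ((Finset.card_union_le _ _).trans
    (add_le_add (Finset.card_image_le.trans (hfib c hc))
      (Finset.card_image_le.trans (hfib _ hc'))))

theorem lamG_div_le {p : ℕ} (hp : p.Prime) {d j k : ℕ} (hd : 1 ≤ d) (hj : 1 ≤ j) (hk : d * k < j)
    (c : Fin (d + 1) → ℤ) (hc : ∃ i, ¬ (p : ℤ) ∣ c i) :
    (lamG d (p ^ j) c : ℝ) / (p : ℝ) ^ (2 * j) ≤ d * ((j : ℝ) + 1) / (p : ℝ) ^ (k + 1) := by
  have hkj : k + 1 ≤ j := by nlinarith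
  have hp0 : (0 : ℝ) < p := by exact_mod_cast hp.pos
  have h : (lamG d (p ^ j) c : ℝ) ≤ 2 * ((p : ℝ) ^ j * ((p : ℝ) ^ (j - (k + 1)) * d)) := by
    exact_mod_cast lamG_prime_pow_le hp hd hk c hc
  rw [div_le_div_iff₀ (by positivity) (by positivity)]
  have hj1 : (1 : ℝ) ≤ j := by exact_mod_cast hj
  calc (lamG d (p ^ j) c : ℝ) * (p : ℝ) ^ (k + 1)
      ≤ 2 * ((p : ℝ) ^ j * ((p : ℝ) ^ (j - (k + 1)) * d)) * (p : ℝ) ^ (k + 1) := by gcongr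
    _ = d * 2 * ((p : ℝ) ^ j * ((p : ℝ) ^ (j - (k + 1)) * (p : ℝ) ^ (k + 1))) := by ring
    _ = d * 2 * (p : ℝ) ^ (2 * j) := by
      rw [← pow_add, Nat.sub_add_cancel hkj, ← pow_add, two_mul j]
    _ ≤ d * ((j : ℝ) + 1) * (p : ℝ) ^ (2 * j) := by gcongr; linarith

theorem summable_tail_two (d e : ℕ) (hd : 1 ≤ d) :
    Summable fun j : ℕ => (d : ℝ) * ((d : ℝ) + (j : ℝ) + 2) ^ (e + 2) /
      (2 : ℝ) ^ (((j : ℝ) + 1) / d) := by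
  have hd0 : (0 : ℝ) < d := by exact_mod_cast hd
  set r : ℝ := (2 : ℝ) ^ (-(1 / (d : ℝ))) with hr
  have hr0 : 0 < r := by positivity
  have hr1 : r < 1 := Real.rpow_lt_one_of_one_lt_of_neg one_lt_two (by
    have : 0 < 1 / (d : ℝ) := by positivity
    linarith)
  have hs : Summable fun n : ℕ => (n : ℝ) ^ (e + 2) * r ^ n :=
    summable_pow_mul_geometric_of_norm_lt_one _ (by rwa [Real.norm_of_nonneg hr0.le])
  have hs' := ((summable_nat_add_iff (d + 2)).2 hs).mul_left (d / r ^ (d + 1))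
  refine hs'.congr fun j => ?_
  have h2 : (2 : ℝ) ^ (((j : ℝ) + 1) / d) = (r ^ (j + 1))⁻¹ := by
    rw [hr, ← Real.rpow_natCast, ← Real.rpow_mul zero_le_two, ← Real.rpow_neg zero_le_two]
    congr 1
    push_cast
    ring
  rw [h2, show j + (d + 2) = (d + 1) + (j + 1) by ring, pow_add r]
  push_cast
  field_simp
  ring

theorem tail_term_le {d : ℕ} (hd : 1 ≤ d) (e : ℕ) {p : ℕ} (hp : p.Prime) (j : ℕ) :
    (d : ℝ) * ((d : ℝ) + (j : ℝ) + 2) ^ (e + 2) / (p : ℝ) ^ (((d : ℝ) + (j : ℝ) + 1) / d) ≤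
      (d : ℝ) * ((d : ℝ) + (j : ℝ) + 2) ^ (e + 2) / (2 : ℝ) ^ (((j : ℝ) + 1) / d) * (1 / p) := by
  have hd0 : (0 : ℝ) < d := by exact_mod_cast hd
  have hp2 : (2 : ℝ) ≤ p := by exact_mod_cast hp.two_le
  have hp0 : (0 : ℝ) < p := by linarith
  rw [div_mul_div_comm, mul_one]
  refine div_le_div_of_nonneg_left (by positivity) (by positivity) ?_
  rw [show ((d : ℝ) + (j : ℝ) + 1) / d = ((j : ℝ) + 1) / d + 1 by field_simp; ring,
    Real.rpow_add hp0, Real.rpow_one]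
  gcongr

/-- Lower bound for the local factor `ξ_p = 1 + Σ_{j≥1} b(p^j) λ_g(p^j)/p^{2j}`
of a separable binary form with content prime to `p`; in particular
`ξ_p = 1 + O_{d,e}(1/p)` and `ξ_p > 0` for `p` large in terms of `d, e`. -/
theorem stmt_18 (d e : ℕ) (hd : 1 ≤ d) (he : 1 ≤ e) :
    ∃ (M : ℕ) (C : ℝ), 0 < C ∧
      ∀ p : ℕ, p.Prime → ∀ c : Fin (d + 1) → ℤ,
        Squarefree (binFormQ d c) → (∃ i, ¬ (p : ℤ) ∣ c i) →
        ∀ b : ℕ → ℝ, (∀ j : ℕ, |b j| ≤ ((j : ℝ) + 1) ^ (e + 1)) →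
        (∀ j : ℕ, 1 ≤ j → (lamG d (p ^ j) c : ℝ) ≤
          ((d : ℝ) + 1) * ((j : ℝ) + 1) *
            min ((p : ℝ) ^ (2 * (j : ℝ) - 1)) ((p : ℝ) ^ ((j : ℝ) * (2 - 1 / d)))) →
        ∀ ξ : ℝ,
          ξ = 1 + ∑' j : ℕ, b (j + 1) * (lamG d (p ^ (j + 1)) c : ℝ) / (p : ℝ) ^ (2 * (j + 1)) →
          (1 - (∑ j ∈ Finset.Icc 1 d, (d : ℝ) * ((j : ℝ) + 1) ^ (e + 2) / p)
              - ∑' j : ℕ, (d : ℝ) * ((d : ℝ) + (j : ℝ) + 2) ^ (e + 2) /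
                  (p : ℝ) ^ (((d : ℝ) + (j : ℝ) + 1) / d) ≤ ξ) ∧
            |ξ - 1| ≤ C / p ∧ (M < p → 0 < ξ) := by
  have hsum2 := summable_tail_two d e hd
  set T₂ : ℕ → ℝ := fun j => (d : ℝ) * ((d : ℝ) + (j : ℝ) + 2) ^ (e + 2) /
    (2 : ℝ) ^ (((j : ℝ) + 1) / d) with hT₂
  set C : ℝ := (∑ j ∈ Finset.Icc 1 d, (d : ℝ) * ((j : ℝ) + 1) ^ (e + 2)) + ∑' j, T₂ j + 1 with hC
  have hC0 : 0 < C := by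
    have h1 : 0 ≤ ∑' j, T₂ j := tsum_nonneg fun j => by positivity
    positivity
  refine ⟨⌈C⌉₊, C, hC0, ?_⟩
  intro p hp c _ hc b hb _ ξ hξ
  have hp0 : (0 : ℝ) < p := by exact_mod_cast hp.pos
  have hp1 : (1 : ℝ) ≤ p := by exact_mod_cast hp.one_le
  have hd0 : (0 : ℝ) < d := by exact_mod_cast hd
  set T : ℕ → ℝ := fun j => (d : ℝ) * ((d : ℝ) + (j : ℝ) + 2) ^ (e + 2) /
    (p : ℝ) ^ (((d : ℝ) + (j : ℝ) + 1) / d) with hT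
  have hTle : ∀ j, T j ≤ T₂ j * (1 / p) := tail_term_le hd e hp
  have hTsum : Summable T :=
    Summable.of_nonneg_of_le (fun j => by positivity) hTle (hsum2.mul_right _)
  set f : ℕ → ℝ := fun j =>
    b (j + 1) * (lamG d (p ^ (j + 1)) c : ℝ) / (p : ℝ) ^ (2 * (j + 1)) with hf
  have hfle : ∀ j k : ℕ, d * k < j + 1 →
      ‖f j‖ ≤ d * ((j : ℝ) + 2) ^ (e + 2) / (p : ℝ) ^ (k + 1) := by
    intro j k hk
    have h1 := lamG_div_le hp hd (Nat.le_add_left 1 j) hk c hc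
    have h2 := hb (j + 1)
    push_cast at h1 h2
    have h3 : ‖f j‖ = |b (j + 1)| * ((lamG d (p ^ (j + 1)) c : ℝ) / (p : ℝ) ^ (2 * (j + 1))) := by
      rw [hf, Real.norm_eq_abs]
      simp only
      rw [mul_div_assoc, abs_mul, abs_of_nonneg (a := _ / _) (by positivity)]
    rw [h3]
    refine (mul_le_mul h2 h1 (by positivity) (by positivity)).trans (le_of_eq ?_)
    ring
  have hhead : ∀ j, ‖f j‖ ≤ d * ((j : ℝ) + 2) ^ (e + 2) / p := by
    intro j
    simpa using hfle j 0 (by simp)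
  have htail : ∀ j, ‖f (j + d)‖ ≤ T j := by
    intro j
    have hlt : d * ((j + d) / d) < j + d + 1 := by
      have := Nat.mul_div_le (j + d) d
      omega
    refine (hfle (j + d) ((j + d) / d) hlt).trans ?_
    have hge : j + d + 1 ≤ d * ((j + d) / d + 1) := Nat.lt_mul_div_succ (j + d) hd
    have hge' : (d : ℝ) + j + 1 ≤ (((j + d) / d + 1 : ℕ) : ℝ) * d := by
      have : ((j + d + 1 : ℕ) : ℝ) ≤ ((d * ((j + d) / d + 1) : ℕ) : ℝ) := by exact_mod_cast hge
      rw [Nat.cast_mul] at this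
      push_cast at this ⊢
      linarith
    rw [hT, ← Real.rpow_natCast (p : ℝ)]
    simp only
    rw [show (((j + d : ℕ) : ℝ) + 2) = (d : ℝ) + j + 2 by push_cast; ring]
    refine div_le_div_of_nonneg_left (by positivity) (by positivity) ?_
    exact Real.rpow_le_rpow_of_exponent_le hp1 ((div_le_iff₀ hd0).2 hge')
  have hfsum : Summable f :=
    (summable_nat_add_iff d).1 (Summable.of_norm_bounded hTsum htail)
  have hIcc : ∑ j ∈ Finset.Icc 1 d, (d : ℝ) * ((j : ℝ) + 1) ^ (e + 2) / p =
      ∑ j ∈ Finset.range d, (d : ℝ) * ((j : ℝ) + 2) ^ (e + 2) / p := by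
    rw [← Finset.Ico_add_one_right_eq_Icc, Finset.sum_Ico_eq_sum_range]
    refine Finset.sum_congr (by simp) fun j _ => ?_
    push_cast
    ring
  have habs : |ξ - 1| ≤
      (∑ j ∈ Finset.Icc 1 d, (d : ℝ) * ((j : ℝ) + 1) ^ (e + 2) / p) + ∑' j, T j := by
    rw [hξ, add_sub_cancel_left, ← hfsum.sum_add_tsum_nat_add d, hIcc]
    refine (abs_add_le _ _).trans (add_le_add ?_ ?_)
    · exact (Finset.abs_sum_le_sum_abs _ _).trans (Finset.sum_le_sum fun j _ => hhead j)
    · exact tsum_of_norm_bounded hTsum.hasSum htail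
  have hCp : |ξ - 1| ≤ C / p := by
    refine habs.trans ?_
    have h1 : ∑' j, T j ≤ (∑' j, T₂ j) * (1 / p) := by
      rw [← tsum_mul_right]
      exact hTsum.tsum_le_tsum hTle (hsum2.mul_right _)
    have h2 : (0 : ℝ) ≤ 1 / p := by positivity
    rw [← Finset.sum_div, hC, add_div, add_div]
    rw [mul_one_div] at h1
    linarith
  refine ⟨?_, hCp, fun hM => ?_⟩
  · have := (abs_le.1 habs).1
    linarith
  · have h1 : C < p := (Nat.le_ceil C).trans_lt (by exact_mod_cast hM)
    have h2 : C / p < 1 := (div_lt_one hp0).2 h1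
    have := (abs_le.1 hCp).1
    linarith
end
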